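/- For all τ ∈ ℂ with Im τ > 0, θ'[1/5; 2/5](0,τ) · θ[1/5; 2/5](0,τ)² · θ[3/5; 1/5](0,τ)³ = −(π/10) · θ[0; 0](0,τ) · θ[0; 1/2](0,τ) · θ[1/2; 0](0,τ) · ( 3·exp(−3πi/5) · θ[1/10; 7/10](0,τ)³ · θ[3/5; 1/5](0,τ)² + θ[3/10; 1/10](0,τ)³ · θ[1/5; 2/5](0,τ)² ), where in [ε'; ε] the first entry is the top characteristic ε' and the second is the bottom characteristic ε. -/

import Mathlib

open Complex

/-- The theta function with characteristic `[ε'; ε]`: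
`θ[ε';ε](z,τ) = Σ_{n∈ℤ} exp(πi(n+ε')²τ + 2πi(n+ε')(z+ε))`. -/
noncomputable def jacobiThetaChar (ε' ε : ℝ) (z τ : ℂ) : ℂ :=
  ∑' n : ℤ, Complex.exp ((Real.pi : ℂ) * Complex.I * ((n : ℂ) + (ε' : ℂ)) ^ 2 * τ +
    2 * (Real.pi : ℂ) * Complex.I * ((n : ℂ) + (ε' : ℂ)) * (z + (ε : ℂ)))

/-- The theta derivative `θ'[ε';ε](0,τ) = ∂_z θ[ε';ε](z,τ) |_{z=0}`. -/
noncomputable def jacobiThetaCharDeriv (ε' ε : ℝ) (τ : ℂ) : ℂ :=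
  deriv (fun z => jacobiThetaChar ε' ε z τ) 0


/-- parity splitting of `ℤ × ℤ`. -/
def parityEquiv : ((ℤ × ℤ) ⊕ (ℤ × ℤ)) ≃ ℤ × ℤ where
  toFun s := Sum.elim (fun p => (p.1 + p.2, p.1 - p.2)) (fun p => (p.1 + p.2 + 1, p.1 - p.2)) s
  invFun p := if (p.1 + p.2) % 2 = 0 then Sum.inl ((p.1 + p.2) / 2, (p.1 - p.2) / 2)
    else Sum.inr ((p.1 + p.2 - 1) / 2, (p.1 - p.2 - 1) / 2)
  left_inv s := by
    rcases s with ⟨u, v⟩ | ⟨u, v⟩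
    · have h : (u + v + (u - v)) % 2 = 0 := by omega
      simp only [Sum.elim_inl, h, if_true]
      congr 2 <;> omega
    · have h : ¬ (u + v + 1 + (u - v)) % 2 = 0 := by omega
      simp only [Sum.elim_inr, h, if_false]
      congr 2 <;> omega
  right_inv p := by
    rcases p with ⟨m, n⟩
    by_cases h : (m + n) % 2 = 0
    · simp only [h, if_true, Sum.elim_inl]
      congr 1 <;> omega
    · simp only [h, if_false, Sum.elim_inr]
      congr 1 <;> omega

theorem theta_prod (x y : ℂ) {τ : ℂ} (hτ : 0 < τ.im) :
    jacobiTheta₂ (x + y) τ * jacobiTheta₂ (x - y) τ =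
      jacobiTheta₂ (2 * x) (2 * τ) * jacobiTheta₂ (2 * y) (2 * τ) +
      cexp (Real.pi * I * (τ + 2 * x + 2 * y)) *
        (jacobiTheta₂ (2 * x + τ) (2 * τ) * jacobiTheta₂ (2 * y + τ) (2 * τ)) := by
  have h2 : 0 < (2 * τ).im := by simpa using hτ
  have S : ∀ z {t : ℂ}, 0 < t.im → Summable fun n : ℤ => ‖jacobiTheta₂_term n z t‖ := fun z t ht =>
    ((summable_jacobiTheta₂_term_iff z t).mpr ht).norm
  unfold jacobiTheta₂
  have key := summable_mul_of_summable_norm (S (x + y) hτ) (S (x - y) hτ)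
  rw [tsum_mul_tsum_of_summable_norm (S _ hτ) (S _ hτ),
    tsum_mul_tsum_of_summable_norm (S _ h2) (S _ h2),
    tsum_mul_tsum_of_summable_norm (S _ h2) (S _ h2), ← parityEquiv.tsum_eq, ← tsum_mul_left]
  have e1 : ∀ p : ℤ × ℤ, jacobiTheta₂_term (parityEquiv (Sum.inl p)).1 (x + y) τ *
      jacobiTheta₂_term (parityEquiv (Sum.inl p)).2 (x - y) τ =
      jacobiTheta₂_term p.1 (2 * x) (2 * τ) * jacobiTheta₂_term p.2 (2 * y) (2 * τ) := by
    intro p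
    simp only [parityEquiv, Equiv.coe_fn_mk, Sum.elim_inl, jacobiTheta₂_term, ← Complex.exp_add]
    congr 1; push_cast; ring
  have e2 : ∀ p : ℤ × ℤ, jacobiTheta₂_term (parityEquiv (Sum.inr p)).1 (x + y) τ *
      jacobiTheta₂_term (parityEquiv (Sum.inr p)).2 (x - y) τ =
      cexp (Real.pi * I * (τ + 2 * x + 2 * y)) *
      (jacobiTheta₂_term p.1 (2 * x + τ) (2 * τ) * jacobiTheta₂_term p.2 (2 * y + τ) (2 * τ)) := by
    intro p
    simp only [parityEquiv, Equiv.coe_fn_mk, Sum.elim_inr, jacobiTheta₂_term, ← Complex.exp_add]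
    congr 1; push_cast; ring
  have key2 := (parityEquiv.summable_iff (f := fun p : ℤ × ℤ => jacobiTheta₂_term p.1 (x + y) τ *
      jacobiTheta₂_term p.2 (x - y) τ)).mpr key
  refine (Summable.tsum_sum (key2.comp_injective Sum.inl_injective)
    (key2.comp_injective Sum.inr_injective)).trans ?_
  congr 1
  · exact tsum_congr e1
  · exact tsum_congr e2

/-- odd theta function, normalised -/
noncomputable def thS (τ z : ℂ) : ℂ := cexp (Real.pi * I * z) * jacobiTheta₂ (z + 1 / 2 + τ / 2) τ

theorem thS_neg (τ z : ℂ) : thS τ (-z) = - thS τ z := by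
  unfold thS
  have h1 := jacobiTheta₂_add_left' (-z - 1 / 2 - τ / 2 + 1) τ
  rw [jacobiTheta₂_add_left] at h1
  have h2 : jacobiTheta₂ (-z - 1 / 2 - τ / 2) τ = jacobiTheta₂ (z + 1 / 2 + τ / 2) τ := by
    rw [← jacobiTheta₂_neg_left]; ring_nf
  rw [show -z + 1 / 2 + τ / 2 = -z - 1 / 2 - τ / 2 + 1 + τ by ring, h1, h2, ← mul_assoc,
    ← Complex.exp_add, ← neg_mul]
  congr 1
  rw [show Real.pi * I * -z + -Real.pi * I * (τ + 2 * (-z - 1 / 2 - τ / 2 + 1)) =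
    Real.pi * I * z + -(Real.pi * I) by ring, Complex.exp_add, Complex.exp_neg, Complex.exp_pi_mul_I]
  norm_num

theorem thS_prod {τ : ℂ} (hτ : 0 < τ.im) (x y : ℂ) :
    thS τ (x + y) * thS τ (x - y) =
      cexp (2 * Real.pi * I * x) * jacobiTheta₂ (2 * x + τ) (2 * τ) * jacobiTheta₂ (2 * y) (2 * τ) -
      jacobiTheta₂ (2 * x) (2 * τ) *
        (cexp (2 * Real.pi * I * y) * jacobiTheta₂ (2 * y + τ) (2 * τ)) := by
  unfold thS
  have h := theta_prod (x + 1 / 2 + τ / 2) y hτ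
  rw [show 2 * (x + 1 / 2 + τ / 2) + τ = 2 * x + 1 + 2 * τ by ring,
    show 2 * (x + 1 / 2 + τ / 2) = 2 * x + τ + 1 by ring,
    jacobiTheta₂_add_left, jacobiTheta₂_add_left', jacobiTheta₂_add_left] at h
  rw [show x + y + 1 / 2 + τ / 2 = x + 1 / 2 + τ / 2 + y by ring,
    show x - y + 1 / 2 + τ / 2 = x + 1 / 2 + τ / 2 - y by ring, mul_mul_mul_comm, h,
    ← Complex.exp_add]
  have e1 : cexp (Real.pi * I * (x + y) + Real.pi * I * (x - y)) = cexp (2 * Real.pi * I * x) := by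
    congr 1; ring
  have e2 : cexp (2 * Real.pi * I * x) * (cexp (Real.pi * I * (τ + (2 * x + τ + 1) + 2 * y)) *
      cexp (-Real.pi * I * (2 * τ + 2 * (2 * x + 1)))) = - cexp (2 * Real.pi * I * y) := by
    rw [← Complex.exp_add, ← Complex.exp_add, show 2 * Real.pi * I * x + (Real.pi * I *
      (τ + (2 * x + τ + 1) + 2 * y) + -Real.pi * I * (2 * τ + 2 * (2 * x + 1))) =
      2 * Real.pi * I * y + -(Real.pi * I) by ring, Complex.exp_add, Complex.exp_neg,
      Complex.exp_pi_mul_I]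
    norm_num
  rw [e1]
  linear_combination (jacobiTheta₂ (2 * x) (2 * τ) * jacobiTheta₂ (2 * y + τ) (2 * τ)) * e2

theorem thS_tri {τ : ℂ} (hτ : 0 < τ.im) (x e : ℂ) :
    thS τ (2 * x + e) * thS τ e * thS τ (2 * x) ^ 2 =
      thS τ (3 * x + e) * thS τ (e - x) * thS τ x ^ 2 +
      thS τ (x + e) ^ 2 * thS τ (3 * x) * thS τ x := by
  have h1 := thS_prod hτ (x + e) x
  have h2 := thS_prod hτ (2 * x) 0
  have h3 := thS_prod hτ (x + e) (2 * x)
  have h4 := thS_prod hτ x 0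
  have h5 := thS_prod hτ (x + e) 0
  have h6 := thS_prod hτ x (2 * x)
  rw [show x + e + x = 2 * x + e by ring, show x + e - x = e by ring] at h1
  rw [show x + e + 2 * x = 3 * x + e by ring, show x + e - 2 * x = e - x by ring] at h3
  rw [show x + 2 * x = 3 * x by ring, show x - 2 * x = -x by ring, thS_neg] at h6
  simp only [add_zero, sub_zero] at h2 h4 h5
  generalize jacobiTheta₂ (2 * x) (2 * τ) = A1 at *
  generalize jacobiTheta₂ (2 * (x + e)) (2 * τ) = A2 at *
  generalize jacobiTheta₂ (2 * (2 * x)) (2 * τ) = A3 at *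
  generalize jacobiTheta₂ (2 * 0) (2 * τ) = A0 at *
  generalize cexp (2 * Real.pi * I * x) * jacobiTheta₂ (2 * x + τ) (2 * τ) = B1 at *
  generalize cexp (2 * Real.pi * I * (x + e)) * jacobiTheta₂ (2 * (x + e) + τ) (2 * τ) = B2 at *
  generalize cexp (2 * Real.pi * I * (2 * x)) * jacobiTheta₂ (2 * (2 * x) + τ) (2 * τ) = B3 at *
  generalize cexp (2 * Real.pi * I * 0) * jacobiTheta₂ (2 * 0 + τ) (2 * τ) = B0 at *
  have g1 : thS τ (2 * x + e) * thS τ e * thS τ (2 * x) ^ 2 =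
    (B2 * A1 - A2 * B1) * (B3 * A0 - A3 * B0) := by rw [← h1, ← h2]; ring
  have g2 : thS τ (3 * x + e) * thS τ (e - x) * thS τ x ^ 2 =
    (B2 * A3 - A2 * B3) * (B1 * A0 - A1 * B0) := by rw [← h3, ← h4]; ring
  have g3 : thS τ (x + e) ^ 2 * thS τ (3 * x) * thS τ x =
    -((B2 * A0 - A2 * B0) * (B1 * A3 - A1 * B3)) := by rw [← h5, ← h6]; ring
  rw [g1, g2, g3]; ring

theorem thS_zero (τ : ℂ) : thS τ 0 = 0 := by
  have := thS_neg τ 0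
  rw [neg_zero] at this
  linear_combination this / 2

theorem theta_half (τ : ℂ) : jacobiTheta₂ (1 / 2 + τ / 2) τ = 0 := by
  have := thS_zero τ
  simpa [thS] using this

theorem thS_diff {τ : ℂ} (hτ : 0 < τ.im) (z : ℂ) : DifferentiableAt ℂ (thS τ) z := by
  have h : DifferentiableAt ℂ (fun z => jacobiTheta₂ (z + 1 / 2 + τ / 2) τ) z :=
    (differentiableAt_jacobiTheta₂_fst (z + 1 / 2 + τ / 2) hτ).comp z
      (f := fun z : ℂ => z + 1 / 2 + τ / 2) (by fun_prop)
  have h2 : DifferentiableAt ℂ (fun z => cexp (Real.pi * I * z)) z := by fun_prop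
  exact h2.mul h

theorem thS_deriv_zero {τ : ℂ} (hτ : 0 < τ.im) :
    HasDerivAt (thS τ) (jacobiTheta₂' (1 / 2 + τ / 2) τ) 0 := by
  have h : HasDerivAt (fun z => jacobiTheta₂ (z + (1 / 2 + τ / 2)) τ)
      (jacobiTheta₂' (0 + (1 / 2 + τ / 2)) τ) 0 :=
    (hasDerivAt_jacobiTheta₂_fst (0 + (1 / 2 + τ / 2)) hτ).comp_add_const 0 _
  have h2 : HasDerivAt (fun z => cexp (Real.pi * I * z)) (cexp (Real.pi * I * 0) *
    (Real.pi * I * 1)) 0 := ((hasDerivAt_id (0 : ℂ)).const_mul _).cexp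
  have h3 := h2.mul h
  rw [zero_add, theta_half] at h3
  have e : thS τ = (fun z => cexp (Real.pi * I * z)) *
      fun z => jacobiTheta₂ (z + (1 / 2 + τ / 2)) τ := by
    funext z
    simp only [thS, Pi.mul_apply, add_assoc]
  rw [e]
  simpa using h3

theorem thS_deriv_neg {τ : ℂ} (z : ℂ) : deriv (thS τ) (-z) = deriv (thS τ) z := by
  have h : (fun y => thS τ (-y)) = fun y => - thS τ y := funext fun y => thS_neg τ y
  have h1 := deriv_comp_neg (thS τ) z
  rw [h, deriv.fun_neg] at h1
  linear_combination h1

theorem thS_tri_deriv {τ : ℂ} (hτ : 0 < τ.im) (x : ℂ) :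
    3 * deriv (thS τ) x * thS τ x ^ 2 * thS τ (3 * x) - thS τ x ^ 3 * deriv (thS τ) (3 * x) =
      jacobiTheta₂' (1 / 2 + τ / 2) τ * thS τ (2 * x) ^ 3 := by
  have D : ∀ c : ℂ, HasDerivAt (fun e => thS τ (c + e)) (deriv (thS τ) c) 0 := by
    intro c
    have := (thS_diff hτ (c + 0)).hasDerivAt.comp_const_add c 0
    simpa using this
  have D0 := thS_deriv_zero hτ
  have L := ((D (2 * x)).mul D0).mul_const (thS τ (2 * x) ^ 2)
  have R := (((D (3 * x)).mul (D (-x))).mul_const (thS τ x ^ 2)).add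
    ((((D x).pow 2).mul_const (thS τ (3 * x))).mul_const (thS τ x))
  have E := (L.congr_of_eventuallyEq (f := _) (Filter.Eventually.of_forall fun e => by
    have := thS_tri hτ x e
    rw [show e - x = -x + e by ring] at this
    exact this.symm)).unique R
  simp only [add_zero, thS_zero, thS_neg, thS_deriv_neg] at E
  norm_num at E
  linear_combination -E

theorem landen_ab {τ : ℂ} (hτ : 0 < τ.im) :
    jacobiTheta₂ 0 τ * jacobiTheta₂ (1 / 2) τ = jacobiTheta₂ (1 / 2) (2 * τ) ^ 2 := by
  have h := theta_prod (1 / 4) (1 / 4) hτ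
  have h0 := theta_half (2 * τ)
  rw [show 2 * τ / 2 = τ by ring] at h0
  norm_num at h h0
  rw [h0] at h
  norm_num
  linear_combination h

theorem landen_c {τ : ℂ} (hτ : 0 < τ.im) :
    jacobiTheta₂ (τ / 2) τ ^ 2 = 2 * jacobiTheta₂ (2 * τ / 2) (2 * τ) * jacobiTheta₂ 0 (2 * τ) := by
  have h := theta_prod (τ / 2) 0 hτ
  have h0 := jacobiTheta₂_add_left' 0 (2 * τ)
  rw [show 2 * (τ / 2) + τ = 0 + 2 * τ by ring, h0] at h
  rw [show 2 * τ / 2 = τ by ring]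
  simp only [add_zero, sub_zero, mul_zero, zero_add] at h
  rw [show 2 * (τ / 2) = τ by ring] at h
  have e : cexp (Real.pi * I * (τ + τ)) * cexp (-Real.pi * I * (2 * τ)) = 1 := by
    rw [← Complex.exp_add, ← Complex.exp_zero]; congr 1; ring
  linear_combination h + jacobiTheta₂ 0 (2 * τ) * jacobiTheta₂ τ (2 * τ) * e

theorem landen_d {τ : ℂ} (hτ : 0 < τ.im) :
    jacobiTheta₂' (1 / 2 + τ / 2) τ * jacobiTheta₂ (τ / 2) τ =
      2 * jacobiTheta₂' (1 / 2 + 2 * τ / 2) (2 * τ) * jacobiTheta₂ (1 / 2) (2 * τ) := by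
  have h2 : 0 < (2 * τ).im := by simpa using hτ
  have h0 := theta_half (2 * τ)
  rw [show 2 * τ / 2 = τ by ring] at h0 ⊢
  have h : ∀ z : ℂ, jacobiTheta₂ (z + (1 / 2 + τ / 2)) τ * jacobiTheta₂ (z + τ / 2) τ =
      jacobiTheta₂ (2 * z + (1 / 2 + τ)) (2 * τ) * jacobiTheta₂ (1 / 2) (2 * τ) := by
    intro z
    have h := theta_prod (z + 1 / 4 + τ / 2) (1 / 4) hτ
    rw [show z + 1 / 4 + τ / 2 + 1 / 4 = z + (1 / 2 + τ / 2) by ring,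
      show z + 1 / 4 + τ / 2 - 1 / 4 = z + τ / 2 by ring,
      show (2 * (1 / 4) : ℂ) = 1 / 2 by norm_num, h0,
      show 2 * (z + 1 / 4 + τ / 2) = 2 * z + (1 / 2 + τ) by ring] at h
    rw [h]; ring
  have D1 : HasDerivAt (fun z => jacobiTheta₂ (z + (1 / 2 + τ / 2)) τ)
      (jacobiTheta₂' (0 + (1 / 2 + τ / 2)) τ) 0 :=
    (hasDerivAt_jacobiTheta₂_fst (0 + (1 / 2 + τ / 2)) hτ).comp_add_const 0 _
  have D2 : HasDerivAt (fun z => jacobiTheta₂ (z + τ / 2) τ)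
      (jacobiTheta₂' (0 + τ / 2) τ) 0 :=
    (hasDerivAt_jacobiTheta₂_fst (0 + τ / 2) hτ).comp_add_const 0 _
  have i3 : HasDerivAt (fun z : ℂ => 2 * z + (1 / 2 + τ)) (2 * 1) 0 :=
    ((hasDerivAt_id (0 : ℂ)).const_mul 2).add_const _
  have D3 : HasDerivAt (fun z => jacobiTheta₂ (2 * z + (1 / 2 + τ)) (2 * τ))
      (jacobiTheta₂' (2 * 0 + (1 / 2 + τ)) (2 * τ) * (2 * 1)) 0 :=
    HasDerivAt.comp (h₂ := fun z => jacobiTheta₂ z (2 * τ)) (0 : ℂ)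
      (hasDerivAt_jacobiTheta₂_fst (2 * 0 + (1 / 2 + τ)) h2) i3
  have E := ((D3.mul_const (jacobiTheta₂ (1 / 2) (2 * τ))).congr_of_eventuallyEq
    (Filter.Eventually.of_forall h)).unique (D1.mul D2)
  simp only [zero_add, mul_zero, theta_half] at E
  linear_combination -E

theorem series_lim {τ : ℂ} (hτ : 0 < τ.im) (w : ℤ → ℂ) (N : ℤ → ℕ)
    (hs : Summable fun n => ‖w n * cexp (Real.pi * I * N n * τ)‖) :
    Filter.Tendsto (fun k : ℕ => ∑' n, w n * cexp (Real.pi * I * N n * (2 ^ k * τ))) Filter.atTop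
      (nhds (∑' n, if N n = 0 then w n else 0)) := by
  have nrm : ∀ n (t : ℂ), ‖cexp (Real.pi * I * N n * t)‖ = Real.exp (-(Real.pi * N n * t.im)) := by
    intro n t
    rw [Complex.norm_exp]
    congr 1
    simp
  have im : ∀ k : ℕ, ((2 : ℂ) ^ k * τ).im = 2 ^ k * τ.im := by
    intro k
    have : ((2 : ℂ) ^ k) = (((2 : ℝ) ^ k : ℝ) : ℂ) := by push_cast; rfl
    rw [this, Complex.im_ofReal_mul]
  refine tendsto_tsum_of_dominated_convergence hs ?_ ?_
  · intro n
    split_ifs with h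
    · simp [h]
    · rw [tendsto_zero_iff_norm_tendsto_zero]
      simp only [norm_mul, nrm, im]
      rw [← mul_zero ‖w n‖]
      refine Filter.Tendsto.const_mul _ (Real.tendsto_exp_neg_atTop_nhds_zero.comp ?_)
      have hp : 0 < Real.pi * N n := by
        have : (0 : ℝ) < N n := by exact_mod_cast Nat.pos_of_ne_zero h
        positivity
      exact Filter.Tendsto.const_mul_atTop hp
        ((tendsto_pow_atTop_atTop_of_one_lt (by norm_num)).atTop_mul_const hτ)
  · refine Filter.Eventually.of_forall fun k n => ?_
    simp only [norm_mul, nrm, im]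
    refine mul_le_mul_of_nonneg_left (Real.exp_le_exp.mpr (neg_le_neg ?_)) (norm_nonneg _)
    have h1 : (1 : ℝ) ≤ 2 ^ k := one_le_pow₀ (by norm_num)
    refine mul_le_mul_of_nonneg_left ?_ (by positivity)
    nlinarith

theorem im_pow {τ : ℂ} (hτ : 0 < τ.im) (k : ℕ) : 0 < ((2 : ℂ) ^ k * τ).im := by
  have : ((2 : ℂ) ^ k) = (((2 : ℝ) ^ k : ℝ) : ℂ) := by push_cast; rfl
  rw [this, Complex.im_ofReal_mul]; positivity

theorem lim_of_term {τ : ℂ} (hτ : 0 < τ.im) (f : ℂ → ℤ → ℂ) (w : ℤ → ℂ) (N : ℤ → ℕ)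
    (hf : ∀ t n, f t n = w n * cexp (Real.pi * I * N n * t)) (hs : Summable (f τ)) :
    Filter.Tendsto (fun k : ℕ => ∑' n, f (2 ^ k * τ) n) Filter.atTop
      (nhds (∑' n, if N n = 0 then w n else 0)) := by
  simp only [hf]
  refine series_lim hτ w N ?_
  have := hs.norm
  simpa only [hf] using this

theorem tsum_one (w : ℤ → ℂ) (hw : w 0 = 1) :
    (∑' n : ℤ, if (n ^ 2).toNat = 0 then w n else 0) = 1 := by
  rw [tsum_eq_single 0]
  · simp [hw]
  · intro n hn
    have : 0 < n ^ 2 := by positivity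
    rw [if_neg (by omega)]

theorem lim_a {τ : ℂ} (hτ : 0 < τ.im) :
    Filter.Tendsto (fun k : ℕ => jacobiTheta₂ 0 (2 ^ k * τ)) Filter.atTop (nhds 1) := by
  have := lim_of_term hτ (fun t n => jacobiTheta₂_term n 0 t) (fun n => 1)
    (fun n => (n ^ 2).toNat) (fun t n => by
      have : (((n ^ 2).toNat : ℤ) : ℂ) = (n : ℂ) ^ 2 := by
        rw [Int.toNat_of_nonneg (sq_nonneg n)]; push_cast; rfl
      rw [Int.cast_natCast] at this
      rw [this, jacobiTheta₂_term, one_mul]; congr 1; ring)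
    ((summable_jacobiTheta₂_term_iff 0 τ).mpr hτ)
  rw [tsum_one (fun n : ℤ => (1 : ℂ)) (by simp)] at this
  exact this

theorem lim_b {τ : ℂ} (hτ : 0 < τ.im) :
    Filter.Tendsto (fun k : ℕ => jacobiTheta₂ (1 / 2) (2 ^ k * τ)) Filter.atTop (nhds 1) := by
  have := lim_of_term hτ (fun t n => jacobiTheta₂_term n (1 / 2) t) (fun n => cexp (Real.pi * I * n))
    (fun n => (n ^ 2).toNat) (fun t n => by
      have : (((n ^ 2).toNat : ℤ) : ℂ) = (n : ℂ) ^ 2 := by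
        rw [Int.toNat_of_nonneg (sq_nonneg n)]; push_cast; rfl
      rw [Int.cast_natCast] at this
      rw [this, jacobiTheta₂_term, ← Complex.exp_add]; congr 1; ring)
    ((summable_jacobiTheta₂_term_iff (1 / 2) τ).mpr hτ)
  rw [tsum_one (fun n : ℤ => cexp (Real.pi * I * n)) (by simp)] at this
  exact this

theorem sq_add_nonneg' (n : ℤ) : 0 ≤ n ^ 2 + n := by
  rcases le_or_gt 0 n with h | h <;> nlinarith

theorem tsum_two (w : ℤ → ℂ) :
    (∑' n : ℤ, if (n ^ 2 + n).toNat = 0 then w n else 0) = w 0 + w (-1) := by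
  rw [tsum_eq_sum (s := {0, -1})]
  · rw [Finset.sum_pair (by norm_num)]; simp
  · intro n hn
    simp only [Finset.mem_insert, Finset.mem_singleton, not_or] at hn
    rw [if_neg]
    intro h
    have h2 := sq_add_nonneg' n
    have h3 : n * (n + 1) = 0 := by
      have : n ^ 2 + n = 0 := by omega
      linear_combination this
    rcases mul_eq_zero.mp h3 with h | h <;> omega

theorem cast_two (n : ℤ) : (((n ^ 2 + n).toNat : ℕ) : ℂ) = (n : ℂ) ^ 2 + n := by
  have : (((n ^ 2 + n).toNat : ℤ) : ℂ) = (n : ℂ) ^ 2 + n := by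
    rw [Int.toNat_of_nonneg (sq_add_nonneg' n)]; push_cast; rfl
  rwa [Int.cast_natCast] at this

theorem lim_c {τ : ℂ} (hτ : 0 < τ.im) :
    Filter.Tendsto (fun k : ℕ => jacobiTheta₂ (2 ^ k * τ / 2) (2 ^ k * τ)) Filter.atTop
      (nhds 2) := by
  have := lim_of_term hτ (fun t n => jacobiTheta₂_term n (t / 2) t) (fun n => 1)
    (fun n => (n ^ 2 + n).toNat) (fun t n => by
      rw [cast_two, jacobiTheta₂_term, one_mul]; congr 1; ring)
    ((summable_jacobiTheta₂_term_iff (τ / 2) τ).mpr hτ)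
  rw [tsum_two] at this
  rw [show (1 + 1 : ℂ) = 2 by norm_num] at this
  exact this

theorem lim_d {τ : ℂ} (hτ : 0 < τ.im) :
    Filter.Tendsto (fun k : ℕ => jacobiTheta₂' (1 / 2 + 2 ^ k * τ / 2) (2 ^ k * τ)) Filter.atTop
      (nhds (2 * Real.pi * I)) := by
  have := lim_of_term hτ (fun t n => jacobiTheta₂'_term n (1 / 2 + t / 2) t)
    (fun n => 2 * Real.pi * I * n * cexp (Real.pi * I * n))
    (fun n => (n ^ 2 + n).toNat) (fun t n => by
      rw [cast_two, jacobiTheta₂'_term, jacobiTheta₂_term, mul_assoc _ (cexp _) (cexp _),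
        ← Complex.exp_add]
      congr 2; ring)
    ((summable_jacobiTheta₂'_term_iff (1 / 2 + τ / 2) τ).mpr hτ)
  rw [tsum_two] at this
  have e : 2 * Real.pi * I * ((0 : ℤ) : ℂ) * cexp (Real.pi * I * ((0 : ℤ) : ℂ)) +
      2 * Real.pi * I * ((-1 : ℤ) : ℂ) * cexp (Real.pi * I * ((-1 : ℤ) : ℂ)) =
      2 * Real.pi * I := by
    push_cast
    rw [mul_neg_one (Real.pi * I : ℂ), Complex.exp_neg, Complex.exp_pi_mul_I]
    norm_num
  rw [e] at this
  exact this

theorem nonvan {τ : ℂ} (hτ : 0 < τ.im) : jacobiTheta₂ 0 τ ≠ 0 ∧ jacobiTheta₂ (1 / 2) τ ≠ 0 ∧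
    jacobiTheta₂ (τ / 2) τ ≠ 0 := by
  have e1 := (lim_a hτ).eventually_ne one_ne_zero
  have e2 := (lim_b hτ).eventually_ne one_ne_zero
  have e3 := (lim_c hτ).eventually_ne two_ne_zero
  obtain ⟨k, h1, h2, h3⟩ := (e1.and (e2.and e3)).exists
  induction k with
  | zero =>
    rw [pow_zero, one_mul] at h1 h2 h3
    exact ⟨h1, h2, h3⟩
  | succ k ih =>
    have hk := im_pow hτ k
    have l1 := landen_ab hk
    have l2 := landen_c hk
    rw [show (2 : ℂ) * (2 ^ k * τ) = 2 ^ (k + 1) * τ by ring] at l1 l2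
    have n1 : jacobiTheta₂ 0 (2 ^ k * τ) * jacobiTheta₂ (1 / 2) (2 ^ k * τ) ≠ 0 := by
      rw [l1]; exact pow_ne_zero 2 h2
    have n2 : jacobiTheta₂ (2 ^ k * τ / 2) (2 ^ k * τ) ^ 2 ≠ 0 := by
      rw [l2]; exact mul_ne_zero (mul_ne_zero two_ne_zero h3) h1
    exact ih (left_ne_zero_of_mul n1) (right_ne_zero_of_mul n1)
      (fun h => n2 (by rw [h]; norm_num))

/-- ratio appearing in Jacobi's derivative formula -/
noncomputable def jr (τ : ℂ) : ℂ := jacobiTheta₂' (1 / 2 + τ / 2) τ /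
  (jacobiTheta₂ 0 τ * jacobiTheta₂ (1 / 2) τ * jacobiTheta₂ (τ / 2) τ)

theorem jr_two {τ : ℂ} (hτ : 0 < τ.im) : jr (2 * τ) = jr τ := by
  have h2 : 0 < (2 * τ).im := by simpa using hτ
  obtain ⟨a, b, c⟩ := nonvan hτ
  obtain ⟨a', b', c'⟩ := nonvan h2
  unfold jr
  rw [div_eq_div_iff (mul_ne_zero (mul_ne_zero a' b') c') (mul_ne_zero (mul_ne_zero a b) c)]
  refine mul_right_cancel₀ c ?_
  have l1 := landen_ab hτ
  have l2 := landen_c hτ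
  have l3 := landen_d hτ
  generalize jacobiTheta₂ 0 τ = A at *
  generalize jacobiTheta₂ (1 / 2) τ = B at *
  generalize jacobiTheta₂ (τ / 2) τ = C at *
  generalize jacobiTheta₂ 0 (2 * τ) = A' at *
  generalize jacobiTheta₂ (1 / 2) (2 * τ) = B' at *
  generalize jacobiTheta₂ (2 * τ / 2) (2 * τ) = C' at *
  generalize jacobiTheta₂' (1 / 2 + τ / 2) τ = D at *
  generalize jacobiTheta₂' (1 / 2 + 2 * τ / 2) (2 * τ) = D' at *
  linear_combination D' * C ^ 2 * l1 + D' * B' ^ 2 * l2 - A' * B' * C' * l3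

theorem jacobi_deriv {τ : ℂ} (hτ : 0 < τ.im) : jacobiTheta₂' (1 / 2 + τ / 2) τ =
    Real.pi * I * (jacobiTheta₂ 0 τ * jacobiTheta₂ (1 / 2) τ * jacobiTheta₂ (τ / 2) τ) := by
  have hk : ∀ k : ℕ, jr (2 ^ k * τ) = jr τ := by
    intro k
    induction k with
    | zero => simp
    | succ k ih => rw [← ih, ← jr_two (im_pow hτ k)]; congr 1; ring
  have L : Filter.Tendsto (fun k : ℕ => jr (2 ^ k * τ)) Filter.atTop
      (nhds (2 * Real.pi * I / (1 * 1 * 2))) :=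
    (lim_d hτ).div (((lim_a hτ).mul (lim_b hτ)).mul (lim_c hτ)) (by norm_num)
  simp only [hk] at L
  have := tendsto_nhds_unique tendsto_const_nhds L
  obtain ⟨a, b, c⟩ := nonvan hτ
  rw [jr, div_eq_iff (mul_ne_zero (mul_ne_zero a b) c)] at this
  rw [this]; ring

theorem char_eq (a b : ℝ) (z τ : ℂ) : jacobiThetaChar a b z τ =
    cexp (Real.pi * I * a ^ 2 * τ + 2 * Real.pi * I * a * (z + b)) *
      jacobiTheta₂ (z + b + a * τ) τ := by
  unfold jacobiThetaChar jacobiTheta₂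
  rw [← tsum_mul_left]
  refine tsum_congr fun n => ?_
  rw [jacobiTheta₂_term, ← Complex.exp_add]
  congr 1; ring

theorem char_thS (a b : ℝ) (z τ : ℂ) : jacobiThetaChar (a + 1 / 2) (b + 1 / 2) z τ =
    cexp (2 * Real.pi * I * a * z) * (cexp (Real.pi * I * ((a ^ 2 + 1 / 4) * τ + 2 * a * b + a + 1 / 2)) *
      thS τ (a * τ + b + z)) := by
  rw [char_eq, thS, ← mul_assoc, ← mul_assoc, ← Complex.exp_add, ← Complex.exp_add]
  push_cast
  congr 1
  · congr 1; ring
  · congr 1; ring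

theorem char_deriv_thS (a b : ℝ) {τ : ℂ} (hτ : 0 < τ.im) :
    jacobiThetaCharDeriv (a + 1 / 2) (b + 1 / 2) τ =
    cexp (Real.pi * I * ((a ^ 2 + 1 / 4) * τ + 2 * a * b + a + 1 / 2)) *
      (deriv (thS τ) (a * τ + b) + 2 * Real.pi * I * a * thS τ (a * τ + b)) := by
  unfold jacobiThetaCharDeriv
  rw [funext fun z => char_thS a b z τ]
  have D : HasDerivAt (fun e => thS τ (a * τ + b + e)) (deriv (thS τ) (a * τ + b)) 0 := by
    have := (thS_diff hτ (a * τ + b + 0)).hasDerivAt.comp_const_add (a * τ + b) 0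
    simpa using this
  have D2 : HasDerivAt (fun z => cexp (2 * Real.pi * I * a * z))
      (cexp (2 * Real.pi * I * a * 0) * (2 * Real.pi * I * a * 1)) 0 :=
    ((hasDerivAt_id (0 : ℂ)).const_mul _).cexp
  have E := (D2.mul (D.const_mul
    (cexp (Real.pi * I * ((a ^ 2 + 1 / 4) * τ + 2 * a * b + a + 1 / 2))))).deriv
  refine Eq.trans E ?_
  simp only [mul_zero, Complex.exp_zero, add_zero]
  ring

theorem char_tri (a b : ℝ) {τ : ℂ} (hτ : 0 < τ.im) :
    3 * jacobiThetaCharDeriv (a + 1 / 2) (b + 1 / 2) τ * jacobiThetaChar (a + 1 / 2) (b + 1 / 2) 0 τ ^ 2 *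
      jacobiThetaChar (3 * a + 1 / 2) (3 * b + 1 / 2) 0 τ -
      jacobiThetaChar (a + 1 / 2) (b + 1 / 2) 0 τ ^ 3 *
        jacobiThetaCharDeriv (3 * a + 1 / 2) (3 * b + 1 / 2) τ =
    cexp (Real.pi * I * (τ / 4 + 1 / 2)) * jacobiTheta₂' (1 / 2 + τ / 2) τ *
      jacobiThetaChar (2 * a + 1 / 2) (2 * b + 1 / 2) 0 τ ^ 3 := by
  have T := thS_tri_deriv hτ (a * τ + b)
  simp only [char_thS, char_deriv_thS _ _ hτ]
  push_cast
  simp only [mul_zero, Complex.exp_zero, one_mul, add_zero]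
  rw [show 3 * (a : ℂ) * τ + 3 * b = 3 * (a * τ + b) by ring,
    show 2 * (a : ℂ) * τ + 2 * b = 2 * (a * τ + b) by ring]
  have E : cexp (Real.pi * I * ((a ^ 2 + 1 / 4) * τ + 2 * a * b + a + 1 / 2)) ^ 3 *
      cexp (Real.pi * I * (((3 * a) ^ 2 + 1 / 4) * τ + 2 * (3 * a) * (3 * b) + 3 * a + 1 / 2)) =
      cexp (Real.pi * I * (τ / 4 + 1 / 2)) *
      cexp (Real.pi * I * (((2 * a) ^ 2 + 1 / 4) * τ + 2 * (2 * a) * (2 * b) + 2 * a + 1 / 2)) ^ 3 := by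
    rw [← Complex.exp_nat_mul, ← Complex.exp_nat_mul, ← Complex.exp_add, ← Complex.exp_add]
    congr 1; push_cast; ring
  generalize cexp (Real.pi * I * ((a ^ 2 + 1 / 4) * τ + 2 * a * b + a + 1 / 2)) = E1 at *
  generalize cexp (Real.pi * I * (((3 * a) ^ 2 + 1 / 4) * τ + 2 * (3 * a) * (3 * b) + 3 * a + 1 / 2)) = E3 at *
  generalize cexp (Real.pi * I * (((2 * a) ^ 2 + 1 / 4) * τ + 2 * (2 * a) * (2 * b) + 2 * a + 1 / 2)) = E2 at *
  linear_combination E1 ^ 3 * E3 * T +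
    jacobiTheta₂' (1 / 2 + τ / 2) τ * thS τ (2 * (a * τ + b)) ^ 3 * E

theorem char_add_one (a b : ℝ) (z τ : ℂ) :
    jacobiThetaChar (a + 1) b z τ = jacobiThetaChar a b z τ := by
  unfold jacobiThetaChar
  rw [← (Equiv.addRight (1 : ℤ)).tsum_eq
    (fun n : ℤ => cexp (Real.pi * I * (n + a) ^ 2 * τ + 2 * Real.pi * I * (n + a) * (z + b)))]
  refine tsum_congr fun n => ?_
  rw [Equiv.coe_addRight]
  congr 1; push_cast; ring

theorem char_add_one' (a b : ℝ) (z τ : ℂ) :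
    jacobiThetaChar a (b + 1) z τ = cexp (2 * Real.pi * I * a) * jacobiThetaChar a b z τ := by
  rw [char_eq, char_eq]
  push_cast
  rw [show z + (b + 1) + a * τ = z + b + a * τ + 1 by ring, jacobiTheta₂_add_left, ← mul_assoc,
    ← Complex.exp_add]
  congr 2; ring

theorem char_neg (a b : ℝ) (z τ : ℂ) :
    jacobiThetaChar (-a) (-b) z τ = jacobiThetaChar a b (-z) τ := by
  rw [char_eq, char_eq]
  push_cast
  rw [← jacobiTheta₂_neg_left]
  congr 2 <;> ring

theorem theta_derivative_fifth (τ : ℂ) (hτ : 0 < τ.im) :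
    jacobiThetaCharDeriv (1 / 5) (2 / 5) τ * jacobiThetaChar (1 / 5) (2 / 5) 0 τ ^ 2 *
        jacobiThetaChar (3 / 5) (1 / 5) 0 τ ^ 3 =
      -((Real.pi : ℂ) / 10) * jacobiThetaChar 0 0 0 τ * jacobiThetaChar 0 (1 / 2) 0 τ *
        jacobiThetaChar (1 / 2) 0 0 τ *
        (3 * Complex.exp (-(3 * (Real.pi : ℂ) * Complex.I / 5)) *
            jacobiThetaChar (1 / 10) (7 / 10) 0 τ ^ 3 *
            jacobiThetaChar (3 / 5) (1 / 5) 0 τ ^ 2 +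
          jacobiThetaChar (3 / 10) (1 / 10) 0 τ ^ 3 *
            jacobiThetaChar (1 / 5) (2 / 5) 0 τ ^ 2) := by
  have T1 := char_tri (-3 / 10) (-1 / 10) hτ
  have T2 := char_tri (-9 / 10) (-3 / 10) hτ
  -- the characteristics [-2/5; 1/5] and [3/5; 1/5]
  have s0 : ∀ z, jacobiThetaChar (-2 / 5) (1 / 5) z τ = jacobiThetaChar (3 / 5) (1 / 5) z τ := by
    intro z
    rw [← char_add_one]; norm_num
  have s1 : jacobiThetaCharDeriv (-2 / 5) (1 / 5) τ = jacobiThetaCharDeriv (3 / 5) (1 / 5) τ := by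
    unfold jacobiThetaCharDeriv; rw [funext s0]
  have t0 : ∀ z, jacobiThetaChar (-11 / 5) (-2 / 5) z τ = jacobiThetaChar (1 / 5) (2 / 5) (-z) τ := by
    intro z
    rw [← char_add_one, ← char_add_one, ← char_neg]; norm_num
  have t1 : jacobiThetaCharDeriv (-11 / 5) (-2 / 5) τ = - jacobiThetaCharDeriv (1 / 5) (2 / 5) τ := by
    unfold jacobiThetaCharDeriv
    rw [funext t0, deriv_comp_neg (fun z => jacobiThetaChar (1 / 5) (2 / 5) z τ), neg_zero]
  have u0 : jacobiThetaChar (-1 / 10) (3 / 10) 0 τ =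
      cexp (-(2 * Real.pi * I / 10)) * jacobiThetaChar (1 / 10) (7 / 10) 0 τ := by
    have h1 := char_neg (1 / 10) (-3 / 10) 0 τ
    have h2 := char_add_one' (1 / 10) (-3 / 10) 0 τ
    norm_num at h1 h2 ⊢
    rw [h1, h2, ← mul_assoc, ← Complex.exp_add,
      show -(2 * (Real.pi : ℂ) * I / 10) + 2 * Real.pi * I * (1 / 10) = 0 by ring]
    simp
  have v0 : jacobiThetaChar (-13 / 10) (-1 / 10) 0 τ = jacobiThetaChar (3 / 10) (1 / 10) 0 τ := by
    rw [← char_add_one]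
    have := char_neg (3 / 10) (1 / 10) 0 τ
    norm_num at this ⊢
    exact this
  have J : cexp (Real.pi * I * (τ / 4 + 1 / 2)) * jacobiTheta₂' (1 / 2 + τ / 2) τ =
      -Real.pi * jacobiThetaChar 0 0 0 τ * jacobiThetaChar 0 (1 / 2) 0 τ *
        jacobiThetaChar (1 / 2) 0 0 τ := by
    rw [jacobi_deriv hτ, char_eq, char_eq, char_eq]
    push_cast
    rw [show 1 / 2 * τ = τ / 2 by ring,
      show Real.pi * I * (τ / 4 + 1 / 2) = Real.pi * I * τ / 4 + Real.pi / 2 * I by ring,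
      Complex.exp_add, Complex.exp_pi_div_two_mul_I,
      show Real.pi * I * (1 / 2) ^ 2 * τ + 2 * Real.pi * I * (1 / 2) * (0 + 0) =
        Real.pi * I * τ / 4 by ring]
    simp only [add_zero, zero_add, mul_zero, zero_mul, ne_eq, OfNat.ofNat_ne_zero,
      not_false_eq_true, zero_pow, Complex.exp_zero, one_mul]
    linear_combination Real.pi * cexp (Real.pi * I * τ / 4) * jacobiTheta₂ 0 τ *
      jacobiTheta₂ (1 / 2) τ * jacobiTheta₂ (τ / 2) τ * Complex.I_sq
  rw [J] at T1 T2
  rw [show (-3 / 10 + 1 / 2 : ℝ) = 1 / 5 by norm_num, show (-1 / 10 + 1 / 2 : ℝ) = 2 / 5 by norm_num,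
    show (3 * (-3 / 10) + 1 / 2 : ℝ) = -2 / 5 by norm_num,
    show (3 * (-1 / 10) + 1 / 2 : ℝ) = 1 / 5 by norm_num,
    show (2 * (-3 / 10) + 1 / 2 : ℝ) = -1 / 10 by norm_num,
    show (2 * (-1 / 10) + 1 / 2 : ℝ) = 3 / 10 by norm_num, s0, s1, u0, mul_pow,
    ← Complex.exp_nat_mul,
    show ((3 : ℕ) : ℂ) * -(2 * Real.pi * I / 10) = -(3 * Real.pi * I / 5) by push_cast; ring] at T1
  rw [show (-9 / 10 + 1 / 2 : ℝ) = -2 / 5 by norm_num, show (-3 / 10 + 1 / 2 : ℝ) = 1 / 5 by norm_num,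
    show (3 * (-9 / 10) + 1 / 2 : ℝ) = -11 / 5 by norm_num,
    show (3 * (-3 / 10) + 1 / 2 : ℝ) = -2 / 5 by norm_num,
    show (2 * (-9 / 10) + 1 / 2 : ℝ) = -13 / 10 by norm_num,
    show (2 * (-3 / 10) + 1 / 2 : ℝ) = -1 / 10 by norm_num, s0, s1, t0, t1, v0, neg_zero] at T2
  linear_combination (3 / 10 * jacobiThetaChar (3 / 5) (1 / 5) 0 τ ^ 2) * T1 +
    (1 / 10 * jacobiThetaChar (1 / 5) (2 / 5) 0 τ ^ 2) * T2
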